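/- Let φ : M → N be a surjective homomorphism between C*-ternary rings. For finitely many g₁,…,gₙ, h₁,…,hₙ ∈ M, define operators on M by B₁x = Σᵢ [x gᵢ hᵢ], B₂x = Σᵢ [x hᵢ gᵢ], A₁x = Σᵢ [gᵢ hᵢ x], A₂x = Σᵢ [hᵢ gᵢ x], and operators on N by B₁'y = Σᵢ [y φ(gᵢ) φ(hᵢ)], B₂'y = Σᵢ [y φ(hᵢ) φ(gᵢ)], A₁'y = Σᵢ [φ(gᵢ) φ(hᵢ) y], A₂'y = Σᵢ [φ(hᵢ) φ(gᵢ) y]. Then max(‖B₁'‖, ‖B₂'‖) ≤ max(‖B₁‖, ‖B₂‖) and max(‖A₁'‖, ‖A₂'‖) ≤ max(‖A₁‖, ‖A₂‖) (operator norms on N and M respectively); in particular the induced maps φ₂₂ : R(M) → R(N) and φ₁₁ : L(M) → L(N) are well defined and contractive. -/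

import Mathlib

/-- A C*-ternary ring: a complex Banach space `Z` (completeness is imposed where needed)
with a triple product `[x y z] = t x y z`, linear in the outer variables, conjugate-linear in
the middle variable, associative in the sense that
`[[v w x] y z] = [v [y x w] z] = [v w [x y z]]`, and satisfying
`‖[x y z]‖ ≤ ‖x‖‖y‖‖z‖` and `‖[x x x]‖ = ‖x‖³`. -/
structure CstarTernary (Z : Type*) [NormedAddCommGroup Z] [NormedSpace ℂ Z] where
  t : Z → Z → Z → Z
  add_left : ∀ x w y z, t (x + w) y z = t x y z + t w y z
  smul_left : ∀ (c : ℂ) (x y z), t (c • x) y z = c • t x y z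
  add_mid : ∀ x y w z, t x (y + w) z = t x y z + t x w z
  smul_mid : ∀ (c : ℂ) (x y z), t x (c • y) z = (starRingEnd ℂ) c • t x y z
  add_right : ∀ x y z w, t x y (z + w) = t x y z + t x y w
  smul_right : ∀ (c : ℂ) (x y z), t x y (c • z) = c • t x y z
  assoc₁ : ∀ v w x y z, t (t v w x) y z = t v (t y x w) z
  assoc₂ : ∀ v w x y z, t (t v w x) y z = t v w (t x y z)
  norm_le : ∀ x y z, ‖t x y z‖ ≤ ‖x‖ * ‖y‖ * ‖z‖
  norm_cube : ∀ x, ‖t x x x‖ = ‖x‖ ^ 3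

namespace CstarTernary

variable {Z : Type*} [NormedAddCommGroup Z] [NormedSpace ℂ Z]

/-- The opposite C*-ternary ring, with product `(x, y, z) ↦ [z y x]`. -/
def opposite (S : CstarTernary Z) : CstarTernary Z where
  t x y z := S.t z y x
  add_left _ _ _ _ := S.add_right _ _ _ _
  smul_left _ _ _ _ := S.smul_right _ _ _ _
  add_mid _ _ _ _ := S.add_mid _ _ _ _
  smul_mid _ _ _ _ := S.smul_mid _ _ _ _
  add_right _ _ _ _ := S.add_left _ _ _ _
  smul_right _ _ _ _ := S.smul_left _ _ _ _
  assoc₁ v w x y z := by rw [← S.assoc₂, S.assoc₁]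
  assoc₂ v w x y z := (S.assoc₂ z y x w v).symm
  norm_le x y z := (S.norm_le z y x).trans_eq (by ring)
  norm_cube := S.norm_cube

lemma zero_left (S : CstarTernary Z) (y z : Z) : S.t 0 y z = 0 := by
  simpa using S.smul_left 0 0 y z

lemma sub_left (S : CstarTernary Z) (x w y z : Z) :
    S.t (x - w) y z = S.t x y z - S.t w y z := by
  rw [eq_sub_iff_add_eq, ← S.add_left, sub_add_cancel]

lemma sub_mid (S : CstarTernary Z) (x y w z : Z) :
    S.t x (y - w) z = S.t x y z - S.t x w z := by
  rw [eq_sub_iff_add_eq, ← S.add_mid, sub_add_cancel]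

lemma sum_left (S : CstarTernary Z) {ι : Type*} (s : Finset ι) (f : ι → Z) (y z : Z) :
    S.t (∑ i ∈ s, f i) y z = ∑ i ∈ s, S.t (f i) y z :=
  map_sum (AddMonoidHom.mk' (fun x => S.t x y z) fun _ _ => S.add_left _ _ _ _) f s

lemma sum_mid (S : CstarTernary Z) {ι : Type*} (s : Finset ι) (f : ι → Z) (x z : Z) :
    S.t x (∑ i ∈ s, f i) z = ∑ i ∈ s, S.t x (f i) z :=
  map_sum (AddMonoidHom.mk' (fun y => S.t x y z) fun _ _ => S.add_mid _ _ _ _) f s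

lemma eq_zero_of_t_self (S : CstarTernary Z) {x : Z} (hx : S.t x x x = 0) : x = 0 := by
  have h := S.norm_cube x
  rw [hx, norm_zero] at h
  exact norm_eq_zero.mp (pow_eq_zero_iff three_ne_zero |>.mp h.symm)

/-- `T'` is an adjoint of `T` with respect to the triple product. -/
def IsAdjoint (S : CstarTernary Z) (T T' : Z →L[ℂ] Z) : Prop :=
  ∀ x y z, S.t (T x) y z = S.t x (T' y) z

lemma isAdjoint_sum (S : CstarTernary Z) {ι : Type*} (s : Finset ι) (g h : ι → Z)
    {T T' : Z →L[ℂ] Z} (hT : ∀ x, T x = ∑ i ∈ s, S.t x (g i) (h i))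
    (hT' : ∀ x, T' x = ∑ i ∈ s, S.t x (h i) (g i)) : S.IsAdjoint T T' := fun x y z => by
  simp only [hT, hT', sum_left, sum_mid, S.assoc₁]

namespace IsAdjoint

variable {S : CstarTernary Z} {T T' U U' : Z →L[ℂ] Z}

lemma mul (hT : S.IsAdjoint T T') (hU : S.IsAdjoint U U') : S.IsAdjoint (T * U) (U' * T') :=
  fun x y z => by simp only [mul_apply_eq_comp, hT _ _ _, hU _ _ _]

lemma pow (hT : S.IsAdjoint T T') (k : ℕ) : S.IsAdjoint (T ^ k) (T' ^ k) := by
  induction k with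
  | zero => exact fun _ _ _ => rfl
  | succ k ih => rw [pow_succ, pow_succ']; exact ih.mul hT

lemma algebraMap_sub (hT : S.IsAdjoint T T') (c : ℂ) :
    S.IsAdjoint (algebraMap ℂ _ c - T) (algebraMap ℂ _ (starRingEnd ℂ c) - T') := fun x y z => by
  simp only [sub_apply, Algebra.algebraMap_eq_smul_one,
    smul_apply, one_apply_eq_self, sub_left, sub_mid,
    S.smul_left, S.smul_mid, Complex.conj_conj, hT x y z]

lemma injective_of_surjective (hT : S.IsAdjoint T T') (hs : Function.Surjective T') :
    Function.Injective T := by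
  rw [injective_iff_map_eq_zero]
  intro x hx
  obtain ⟨y, hy⟩ := hs x
  apply S.eq_zero_of_t_self
  have h := hT x y x
  rw [hx, hy, S.zero_left] at h
  exact h.symm

lemma norm_sq_le (hT : S.IsAdjoint T T') : ‖T‖ ^ 2 ≤ ‖T' * T‖ := by
  suffices h : ‖T‖ ≤ √‖T' * T‖ from
    (pow_le_pow_left₀ (norm_nonneg _) h 2).trans_eq (Real.sq_sqrt (norm_nonneg _))
  refine T.opNorm_le_bound (Real.sqrt_nonneg _) fun x => ?_
  rw [← abs_of_nonneg (norm_nonneg x), ← Real.sqrt_sq_eq_abs, ← Real.sqrt_mul (norm_nonneg _)]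
  refine Real.le_sqrt_of_sq_le ?_
  rcases eq_or_ne (T x) 0 with h0 | h0
  · rw [h0, norm_zero, zero_pow two_ne_zero]; positivity
  have hpos : 0 < ‖T x‖ := norm_pos_iff.mpr h0
  have h1 : ‖T x‖ ^ 3 ≤ ‖x‖ * ‖(T' * T) x‖ * ‖T x‖ := by
    rw [← S.norm_cube, hT]
    exact S.norm_le _ _ _
  have h2 : ‖x‖ * ‖(T' * T) x‖ ≤ ‖T' * T‖ * ‖x‖ ^ 2 := by
    nlinarith [(T' * T).le_opNorm x, norm_nonneg x]
  nlinarith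

lemma norm_sq_eq (hT : S.IsAdjoint T T) : ‖T ^ 2‖ = ‖T‖ ^ 2 :=
  le_antisymm (norm_pow_le' T two_pos) (by simpa only [pow_two] using hT.norm_sq_le)

lemma nnnorm_pow_two_pow (hT : S.IsAdjoint T T) (k : ℕ) : ‖T ^ 2 ^ k‖₊ = ‖T‖₊ ^ 2 ^ k := by
  induction k with
  | zero => simp
  | succ k ih =>
    rw [pow_succ 2 k, pow_mul, pow_mul, ← ih]
    exact NNReal.eq (hT.pow (2 ^ k)).norm_sq_eq

lemma spectralRadius_eq_nnnorm [CompleteSpace Z] (hT : S.IsAdjoint T T) :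
    spectralRadius ℂ T = ‖T‖₊ := by
  have hconst : Filter.Tendsto (fun _ : ℕ => (‖T‖₊ : ENNReal)) Filter.atTop _ := tendsto_const_nhds
  refine tendsto_nhds_unique ?_ hconst
  convert
    (spectrum.pow_nnnorm_pow_one_div_tendsto_nhds_spectralRadius T).comp
      (tendsto_pow_atTop_atTop_of_one_lt one_lt_two) using 1
  refine funext fun k => ?_
  rw [Function.comp_apply, hT.nnnorm_pow_two_pow, ENNReal.coe_pow, ← ENNReal.rpow_natCast,
    ← ENNReal.rpow_mul]
  simp

end IsAdjoint

section Intertwine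

variable {M : Type*} [NormedAddCommGroup M] [NormedSpace ℂ M] [CompleteSpace M]
  {N : Type*} [NormedAddCommGroup N] [NormedSpace ℂ N]

/-- A surjective linear map (not assumed continuous) carries the surjectivity of `c - C` beyond the
norm of `C` over to any operator it intertwines with `C`. -/
lemma surjective_algebraMap_sub {φ : M →ₗ[ℂ] N} (hφ : Function.Surjective φ)
    {C : M →L[ℂ] M} {C' : N →L[ℂ] N} (hC : ∀ x, C' (φ x) = φ (C x)) {c : ℂ} (hc : ‖C‖ < ‖c‖) :
    Function.Surjective (algebraMap ℂ (N →L[ℂ] N) c - C') := by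
  have hu : c ∈ resolventSet ℂ C := spectrum.mem_resolventSet_of_norm_lt_mul
    ((mul_le_of_le_one_right (norm_nonneg _) ContinuousLinearMap.norm_id_le).trans_lt hc)
  have hs := (ContinuousLinearMap.isUnit_iff_bijective.mp
    (spectrum.mem_resolventSet_iff.mp hu)).2
  intro y
  obtain ⟨x, rfl⟩ := hφ y
  obtain ⟨w, rfl⟩ := hs x
  refine ⟨φ w, ?_⟩
  simp [Algebra.algebraMap_eq_smul_one, hC]

variable [CompleteSpace N]

lemma IsAdjoint.norm_le_of_intertwine {S : CstarTernary N} {φ : M →ₗ[ℂ] N}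
    (hφ : Function.Surjective φ) {C : M →L[ℂ] M} {C' : N →L[ℂ] N}
    (hC : ∀ x, C' (φ x) = φ (C x)) (hadj : S.IsAdjoint C' C') : ‖C'‖ ≤ ‖C‖ := by
  have h : spectralRadius ℂ C' ≤ ‖C‖₊ := by
    refine iSup₂_le fun c hc => ?_
    by_contra! hlt
    have hlt' : ‖C‖ < ‖c‖ := by exact_mod_cast hlt
    refine hc (spectrum.mem_resolventSet_iff.mpr (ContinuousLinearMap.isUnit_iff_bijective.mpr
      ⟨(hadj.algebraMap_sub c).injective_of_surjective (surjective_algebraMap_sub hφ hC ?_),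
        surjective_algebraMap_sub hφ hC hlt'⟩))
    rwa [RCLike.norm_conj]
  rw [hadj.spectralRadius_eq_nnnorm] at h
  exact_mod_cast h

lemma IsAdjoint.norm_le_max {S : CstarTernary N} {φ : M →ₗ[ℂ] N}
    (hφ : Function.Surjective φ) {T U : M →L[ℂ] M} {T' U' : N →L[ℂ] N}
    (hT : ∀ x, T' (φ x) = φ (T x)) (hU : ∀ x, U' (φ x) = φ (U x))
    (hTU : S.IsAdjoint T' U') (hUT : S.IsAdjoint U' T') : ‖T'‖ ≤ max ‖T‖ ‖U‖ := by
  refine le_of_sq_le_sq ?_ (le_max_of_le_left (norm_nonneg _))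
  calc ‖T'‖ ^ 2 ≤ ‖U' * T'‖ := hTU.norm_sq_le
    _ ≤ ‖U * T‖ := (hUT.mul hTU).norm_le_of_intertwine hφ fun x => by simp [hT, hU]
    _ ≤ ‖U‖ * ‖T‖ := norm_mul_le _ _
    _ ≤ max ‖T‖ ‖U‖ ^ 2 := by
      rw [pow_two]
      gcongr
      exacts [le_max_right _ _, le_max_left _ _]

lemma max_norm_le_max_norm (SM : CstarTernary M) (SN : CstarTernary N)
    {φ : M →ₗ[ℂ] N} (hφ : Function.Surjective φ)
    (hhom : ∀ x y z, φ (SM.t x y z) = SN.t (φ x) (φ y) (φ z))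
    {ι : Type*} (s : Finset ι) (g h : ι → M) {T U : M →L[ℂ] M} {T' U' : N →L[ℂ] N}
    (hT : ∀ x, T x = ∑ i ∈ s, SM.t x (g i) (h i))
    (hU : ∀ x, U x = ∑ i ∈ s, SM.t x (h i) (g i))
    (hT' : ∀ y, T' y = ∑ i ∈ s, SN.t y (φ (g i)) (φ (h i)))
    (hU' : ∀ y, U' y = ∑ i ∈ s, SN.t y (φ (h i)) (φ (g i))) :
    max ‖T'‖ ‖U'‖ ≤ max ‖T‖ ‖U‖ := by
  have hTφ : ∀ x, T' (φ x) = φ (T x) := fun x => by simp only [hT, hT', map_sum, hhom]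
  have hUφ : ∀ x, U' (φ x) = φ (U x) := fun x => by simp only [hU, hU', map_sum, hhom]
  have hTU := SN.isAdjoint_sum s (φ ∘ g) (φ ∘ h) hT' hU'
  have hUT := SN.isAdjoint_sum s (φ ∘ h) (φ ∘ g) hU' hT'
  exact max_le (hTU.norm_le_max hφ hTφ hUφ hUT)
    ((hUT.norm_le_max hφ hUφ hTφ hTU).trans_eq (max_comm _ _))

end Intertwine

end CstarTernary

/-- Let `φ : M → N` be a surjective homomorphism between C*-ternary rings.  For
`g₁,…,gₙ, h₁,…,hₙ ∈ M`, with `B₁ x = Σᵢ [x gᵢ hᵢ]`, `B₂ x = Σᵢ [x hᵢ gᵢ]`,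
`A₁ x = Σᵢ [gᵢ hᵢ x]`, `A₂ x = Σᵢ [hᵢ gᵢ x]` on `M` and the corresponding operators
`B₁', B₂', A₁', A₂'` on `N` built from the images `φ gᵢ, φ hᵢ`, one has
`max(‖B₁'‖, ‖B₂'‖) ≤ max(‖B₁‖, ‖B₂‖)` and `max(‖A₁'‖, ‖A₂'‖) ≤ max(‖A₁‖, ‖A₂‖)`;
in particular the induced maps `φ₂₂ : R(M) → R(N)` and `φ₁₁ : L(M) → L(N)` are well
defined and contractive. -/
theorem cstarTernary_induced_maps_contractive
    {M : Type*} [NormedAddCommGroup M] [NormedSpace ℂ M] [CompleteSpace M]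
    {N : Type*} [NormedAddCommGroup N] [NormedSpace ℂ N] [CompleteSpace N]
    (SM : CstarTernary M) (SN : CstarTernary N)
    (φ : M →ₗ[ℂ] N) (hsurj : Function.Surjective φ)
    (hhom : ∀ x y z, φ (SM.t x y z) = SN.t (φ x) (φ y) (φ z))
    (n : ℕ) (g h : Fin n → M)
    (B₁ B₂ A₁ A₂ : M →L[ℂ] M) (B₁' B₂' A₁' A₂' : N →L[ℂ] N)
    (hB₁ : ∀ x, B₁ x = ∑ i, SM.t x (g i) (h i))
    (hB₂ : ∀ x, B₂ x = ∑ i, SM.t x (h i) (g i))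
    (hA₁ : ∀ x, A₁ x = ∑ i, SM.t (g i) (h i) x)
    (hA₂ : ∀ x, A₂ x = ∑ i, SM.t (h i) (g i) x)
    (hB₁' : ∀ y, B₁' y = ∑ i, SN.t y (φ (g i)) (φ (h i)))
    (hB₂' : ∀ y, B₂' y = ∑ i, SN.t y (φ (h i)) (φ (g i)))
    (hA₁' : ∀ y, A₁' y = ∑ i, SN.t (φ (g i)) (φ (h i)) y)
    (hA₂' : ∀ y, A₂' y = ∑ i, SN.t (φ (h i)) (φ (g i)) y) :
    max ‖B₁'‖ ‖B₂'‖ ≤ max ‖B₁‖ ‖B₂‖ ∧ max ‖A₁'‖ ‖A₂'‖ ≤ max ‖A₁‖ ‖A₂‖ := by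
  exact ⟨SM.max_norm_le_max_norm SN hsurj hhom _ g h hB₁ hB₂ hB₁' hB₂',
    SM.opposite.max_norm_le_max_norm SN.opposite hsurj (fun x y z => hhom z y x) _ h g
      hA₁ hA₂ hA₁' hA₂'⟩
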